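/- Let −1/2 < κ < 0, k₁ > 0 and k₂ > ((1−κ²)/(2+κ)) · 2^{(1−4κ−3κ²)/(1−κ²)} · k₁^{1/(1+κ)} be given. Then the origin 0 ∈ ℝ² is small-time stable for the double integrator system ẋ₁ = x₂, ẋ₂ = u with the feedback law u(x₁,x₂) = −k₂ ⌊ ⌊x₂⌉^{(1−κ)/(1+κ)} + k₁^{(1−κ)/(1+κ)} ⌊x₁⌉^{1−κ} ⌉^{(1+2κ)/(1−κ)}. -/

import Mathlib

open Set Filter

/-- Signed power: `⌊x⌉^a = sign(x) * |x|^a`. -/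
noncomputable def spow (x a : ℝ) : ℝ := Real.sign x * |x| ^ a

/-- Dilation `Λ_r(l, x) = (l^{r₁} x₁, …, l^{rₙ} xₙ)`. -/
noncomputable def dil {n : ℕ} (r : Fin n → ℝ) (l : ℝ) (x : Fin n → ℝ) : Fin n → ℝ :=
  fun i => l ^ r i * x i

/-- `x` is a solution of `ẋ = F(x)` on `[s, ∞)`. -/
def IsSolOn {E : Type*} [NormedAddCommGroup E] [NormedSpace ℝ E]
    (F : E → E) (x : ℝ → E) (s : ℝ) : Prop :=
  ∀ t ∈ Set.Ici s, HasDerivWithinAt x (F (x t)) (Set.Ici s) t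

/-- The origin is (locally) asymptotically stable for `ẋ = F(x)`. -/
def AsympStable {E : Type*} [NormedAddCommGroup E] [NormedSpace ℝ E] (F : E → E) : Prop :=
  (∀ ε > 0, ∃ η > 0, ∀ x : ℝ → E, IsSolOn F x 0 → ‖x 0‖ < η → ∀ t ≥ 0, ‖x t‖ < ε) ∧
  (∃ δ > 0, ∀ x : ℝ → E, IsSolOn F x 0 → ‖x 0‖ < δ →
    Filter.Tendsto x Filter.atTop (nhds 0))

/-- The origin is small-time stable for `ẋ = F(x)`. -/
def SmallTimeStable {E : Type*} [NormedAddCommGroup E] [NormedSpace ℝ E] (F : E → E) : Prop :=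
  ∀ ε > 0, ∃ η > 0, ∀ x : ℝ → E, IsSolOn F x 0 → ‖x 0‖ < η →
    x ε = 0 ∧ ∀ t ≥ 0, ‖x t‖ < ε

theorem spow_zero_left (a : ℝ) : spow 0 a = 0 := by simp [spow]

theorem spow_of_pos {x : ℝ} (hx : 0 < x) (a : ℝ) : spow x a = x ^ a := by
  simp [spow, Real.sign_of_pos hx, abs_of_pos hx]

theorem spow_neg_left (x a : ℝ) : spow (-x) a = -spow x a := by
  simp [spow, Real.sign_neg]

theorem spow_of_nonneg {x a : ℝ} (hx : 0 ≤ x) (ha : 0 < a) : spow x a = x ^ a := by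
  rcases hx.eq_or_lt with rfl | h
  · rw [spow_zero_left, Real.zero_rpow ha.ne']
  · exact spow_of_pos h a

theorem spow_mul_of_pos {l : ℝ} (hl : 0 < l) (x a : ℝ) : spow (l * x) a = l ^ a * spow x a := by
  rcases lt_trichotomy x 0 with h | rfl | h
  · obtain ⟨y, rfl⟩ : ∃ y, x = -y := ⟨-x, by ring⟩
    have hy : 0 < y := by linarith
    rw [mul_neg, spow_neg_left, spow_neg_left, spow_of_pos (by positivity), spow_of_pos hy,
      Real.mul_rpow hl.le hy.le, mul_neg]
  · simp [spow_zero_left]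
  · rw [spow_of_pos (by positivity), spow_of_pos h, Real.mul_rpow hl.le h.le]

theorem spow_spow (x a b : ℝ) : spow (spow x a) b = spow x (a * b) := by
  rcases lt_trichotomy x 0 with h | rfl | h
  · obtain ⟨y, rfl⟩ : ∃ y, x = -y := ⟨-x, by ring⟩
    have hy : 0 < y := by linarith
    rw [spow_neg_left, spow_neg_left, spow_neg_left, spow_of_pos hy, spow_of_pos hy,
      spow_of_pos (by positivity), Real.rpow_mul hy.le]
  · simp [spow_zero_left]
  · rw [spow_of_pos h, spow_of_pos h, spow_of_pos (by positivity), Real.rpow_mul h.le]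

theorem mul_spow_self {a : ℝ} (ha : 0 < a + 1) (x : ℝ) : x * spow x a = |x| ^ (a + 1) := by
  rcases lt_trichotomy x 0 with h | rfl | h
  · obtain ⟨y, rfl⟩ : ∃ y, x = -y := ⟨-x, by ring⟩
    have hy : 0 < y := by linarith
    rw [spow_neg_left, spow_of_pos hy, abs_neg, abs_of_pos hy, Real.rpow_add_one hy.ne']
    ring
  · simp [Real.zero_rpow ha.ne']
  · rw [spow_of_pos h, abs_of_pos h, Real.rpow_add_one h.ne']
    ring

theorem abs_rpow_sub_one_mul_self (x a : ℝ) : |x| ^ (a - 1) * x = spow x a := by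
  rcases lt_trichotomy x 0 with h | rfl | h
  · obtain ⟨y, rfl⟩ : ∃ y, x = -y := ⟨-x, by ring⟩
    have hy : 0 < y := by linarith
    rw [spow_neg_left, spow_of_pos hy, abs_neg, abs_of_pos hy, Real.rpow_sub_one hy.ne']
    field_simp
  · simp [spow_zero_left]
  · rw [spow_of_pos h, abs_of_pos h, Real.rpow_sub_one h.ne']
    field_simp

theorem continuous_spow {a : ℝ} (ha : 0 < a) : Continuous fun x => spow x a := by
  have h : (fun x => spow x a) = fun x => (max x 0) ^ a - (max (-x) 0) ^ a := by
    funext x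
    rcases le_total 0 x with h | h
    · rw [spow_of_nonneg h ha, max_eq_left h, max_eq_right (by linarith), Real.zero_rpow ha.ne',
        sub_zero]
    · obtain ⟨y, rfl⟩ : ∃ y, x = -y := ⟨-x, by ring⟩
      have hy : 0 ≤ y := by linarith
      rw [spow_neg_left, spow_of_nonneg hy ha, max_eq_right h, neg_neg, max_eq_left hy,
        Real.zero_rpow ha.ne', zero_sub]
  rw [h]
  exact ((continuous_id.max continuous_const).rpow_const fun _ => Or.inr ha.le).sub
    ((continuous_neg.max continuous_const).rpow_const fun _ => Or.inr ha.le)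

theorem strictMono_spow {a : ℝ} (ha : 0 < a) : StrictMono fun x => spow x a := by
  intro x y hxy
  change spow x a < spow y a
  rcases le_or_gt 0 x with hx | hx
  · rw [spow_of_nonneg hx ha, spow_of_nonneg (hx.trans hxy.le) ha]
    exact Real.rpow_lt_rpow hx hxy ha
  · obtain ⟨z, rfl⟩ : ∃ z, x = -z := ⟨-x, by ring⟩
    have hz : 0 < z := by linarith
    rw [spow_neg_left, spow_of_pos hz]
    have hza : 0 < z ^ a := by positivity
    rcases le_or_gt 0 y with hy | hy
    · rw [spow_of_nonneg hy ha]
      have : 0 ≤ y ^ a := by positivity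
      linarith
    · obtain ⟨w, rfl⟩ : ∃ w, y = -w := ⟨-y, by ring⟩
      have hw : 0 < w := by linarith
      rw [spow_neg_left, spow_of_pos hw, neg_lt_neg_iff]
      exact Real.rpow_lt_rpow hw.le (by linarith) ha

/-- A nonnegative function with `w' ≤ -c w^θ`, `θ < 1`, is nonincreasing and vanishes after the
time `w(0)^{1-θ} / (c (1-θ))`. -/
theorem finite_time_extinction {w w' : ℝ → ℝ} {c θ : ℝ} (hc : 0 < c) (hθ : θ < 1)
    (hw : ∀ t, 0 ≤ t → HasDerivWithinAt w (w' t) (Ici 0) t) (hw0 : ∀ t, 0 ≤ t → 0 ≤ w t)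
    (hle : ∀ t, 0 ≤ t → w' t ≤ -c * w t ^ θ) :
    AntitoneOn w (Ici 0) ∧ ∀ T, 0 ≤ T → w 0 ^ (1 - θ) < c * (1 - θ) * T → w T = 0 := by
  have hcont : ContinuousOn w (Ici 0) := fun t ht => (hw t ht).continuousWithinAt
  have hder : ∀ t, 0 < t → HasDerivAt w (w' t) t := fun t ht =>
    (hw t ht.le).hasDerivAt (Ici_mem_nhds ht)
  have hanti : AntitoneOn w (Ici 0) := by
    refine antitoneOn_of_deriv_nonpos (convex_Ici 0) hcont ?_ ?_
    · intro t ht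
      rw [interior_Ici] at ht
      exact (hder t ht).differentiableAt.differentiableWithinAt
    · intro t ht
      rw [interior_Ici] at ht
      have ht' : (0 : ℝ) < t := ht
      rw [(hder t ht).deriv]
      have h1 := hle t ht'.le
      have h2 : 0 ≤ c * w t ^ θ := mul_nonneg hc.le (Real.rpow_nonneg (hw0 t ht'.le) _)
      linarith
  refine ⟨hanti, fun T hT hlt => ?_⟩
  by_contra hne
  have hTpos : 0 < w T := lt_of_le_of_ne (hw0 T hT) (Ne.symm hne)
  have hpos : ∀ t ∈ Icc 0 T, 0 < w t := fun t ht =>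
    hTpos.trans_le (hanti ht.1 hT ht.2)
  have hφ : AntitoneOn (fun t => w t ^ (1 - θ) + c * (1 - θ) * t) (Icc 0 T) := by
    have hd : ∀ t ∈ Ioo 0 T, HasDerivAt (fun t => w t ^ (1 - θ) + c * (1 - θ) * t)
        (w' t * (1 - θ) * w t ^ (1 - θ - 1) + c * (1 - θ)) t := fun t ht => by
      have h1 := (hder t ht.1).rpow_const (p := 1 - θ)
        (Or.inl (hpos t (Ioo_subset_Icc_self ht)).ne')
      exact (h1.add ((hasDerivAt_id t).const_mul (c * (1 - θ)))).congr_deriv (by rw [mul_one])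
    refine antitoneOn_of_deriv_nonpos (convex_Icc 0 T) ?_ ?_ ?_
    · refine ContinuousOn.add ?_ (by fun_prop)
      exact (hcont.mono Icc_subset_Ici_self).rpow_const fun t ht => Or.inl (hpos t ht).ne'
    · intro t ht
      rw [interior_Icc] at ht
      exact (hd t ht).differentiableAt.differentiableWithinAt
    · intro t ht
      rw [interior_Icc] at ht
      rw [(hd t ht).deriv]
      have hp := hpos t (Ioo_subset_Icc_self ht)
      have h1 := hle t ht.1.le
      have h2 : w t ^ θ * w t ^ (1 - θ - 1) = 1 := by
        rw [← Real.rpow_add hp]; simp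
      have h3 : 0 ≤ (1 - θ) * w t ^ (1 - θ - 1) :=
        mul_nonneg (by linarith) (Real.rpow_nonneg hp.le _)
      have h4 := mul_le_mul_of_nonneg_right h1 h3
      have h5 : -c * w t ^ θ * ((1 - θ) * w t ^ (1 - θ - 1)) = -c * (1 - θ) := by
        linear_combination (-c * (1 - θ)) * h2
      linarith
  have h := hφ (left_mem_Icc.2 hT) (right_mem_Icc.2 hT) hT
  have : 0 ≤ w T ^ (1 - θ) := Real.rpow_nonneg hTpos.le _
  simp only [mul_zero, add_zero] at h
  linarith

/-- The energy `x₂² / 2 + K |x₁|^{2ρ} / (2ρ)`. -/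
noncomputable def energy (K ρ : ℝ) (p : ℝ × ℝ) : ℝ := p.2 ^ 2 / 2 + K / (2 * ρ) * |p.1| ^ (2 * ρ)

theorem energy_nonneg {K ρ : ℝ} (hK : 0 < K) (hρ : 0 < ρ) (p : ℝ × ℝ) : 0 ≤ energy K ρ p := by
  unfold energy; positivity

theorem energy_pos {K ρ : ℝ} (hK : 0 < K) (hρ : 0 < ρ) {p : ℝ × ℝ} (hp : p ≠ 0) :
    0 < energy K ρ p := by
  unfold energy
  by_cases h : p.1 = 0
  · have h2 : p.2 ≠ 0 := fun h2 => hp (Prod.ext h h2)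
    positivity
  · positivity

theorem continuous_energy {K ρ : ℝ} (hρ : 0 < ρ) : Continuous (energy K ρ) := by
  unfold energy
  have : Continuous fun p : ℝ × ℝ => |p.1| ^ (2 * ρ) :=
    continuous_fst.abs.rpow_const fun _ => Or.inr (by positivity)
  fun_prop

theorem energy_dilation {K ρ l : ℝ} (hl : 0 < l) (y : ℝ × ℝ) :
    energy K ρ (l * y.1, l ^ ρ * y.2) = l ^ (2 * ρ) * energy K ρ y := by
  have h : (l ^ ρ) ^ 2 = l ^ (2 * ρ) := by
    rw [← Real.rpow_natCast, ← Real.rpow_mul hl.le]; congr 1; push_cast; ring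
  simp only [energy, abs_mul, abs_of_pos hl, Real.mul_rpow hl.le (abs_nonneg _), mul_pow, h]
  ring

theorem norm_lt_of_energy_lt {K ρ ε : ℝ} (hK : 0 < K) (hρ : 0 < ρ) (hε : 0 < ε) {p : ℝ × ℝ}
    (h : energy K ρ p < min (ε ^ 2 / 2) (K / (2 * ρ) * ε ^ (2 * ρ))) : ‖p‖ < ε := by
  obtain ⟨h1, h2⟩ := lt_min_iff.1 h
  unfold energy at h1 h2
  have hA : 0 ≤ K / (2 * ρ) * |p.1| ^ (2 * ρ) := by positivity
  have hB : 0 ≤ p.2 ^ 2 / 2 := by positivity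
  rw [Prod.norm_def, max_lt_iff, Real.norm_eq_abs, Real.norm_eq_abs]
  constructor
  · have h3 : K / (2 * ρ) * |p.1| ^ (2 * ρ) < K / (2 * ρ) * ε ^ (2 * ρ) := by linarith
    have h4 := lt_of_mul_lt_mul_left h3 (by positivity)
    exact (Real.rpow_lt_rpow_iff (abs_nonneg _) hε.le (by positivity)).1 h4
  · exact abs_lt_of_sq_lt_sq (by linarith) hε.le

theorem isCompact_energy_eq_one {K ρ : ℝ} (hK : 0 < K) (hρ : 0 < ρ) :
    IsCompact {p | energy K ρ p = 1} := by
  refine Metric.isCompact_of_isClosed_isBounded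
    (isClosed_eq (continuous_energy hρ) continuous_const) ?_
  have h1 : Tendsto (fun ε : ℝ => ε ^ 2 / 2) atTop atTop :=
    (tendsto_pow_atTop two_ne_zero).atTop_div_const two_pos
  have h2 : Tendsto (fun ε : ℝ => K / (2 * ρ) * ε ^ (2 * ρ)) atTop atTop :=
    (tendsto_rpow_atTop (by positivity)).const_mul_atTop (by positivity)
  obtain ⟨ε, hε, he1, he2⟩ := ((eventually_gt_atTop 0).and
    ((h1.eventually_gt_atTop 1).and (h2.eventually_gt_atTop 1))).exists
  refine (Metric.isBounded_ball (x := (0 : ℝ × ℝ)) (r := ε)).subset fun p hp => ?_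
  rw [mem_ball_zero_iff]
  refine norm_lt_of_energy_lt hK hρ hε ?_
  rw [show energy K ρ p = 1 from hp]
  exact lt_min he1 he2

/-- A homogeneous function bounded above on the energy sphere is bounded by a power of the
energy. -/
theorem le_mul_energy_rpow_of_homogeneous {K ρ d M : ℝ} (hK : 0 < K) (hρ : 0 < ρ)
    {f : ℝ × ℝ → ℝ} (hf : ∀ l > 0, ∀ y : ℝ × ℝ, f (l * y.1, l ^ ρ * y.2) = l ^ d * f y)
    (hM : ∀ y, energy K ρ y = 1 → f y ≤ M) {p : ℝ × ℝ} (hp : p ≠ 0) :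
    f p ≤ M * energy K ρ p ^ (d / (2 * ρ)) := by
  have hE := energy_pos hK hρ hp
  set l := energy K ρ p ^ (1 / (2 * ρ)) with hl
  have hl0 : 0 < l := by positivity
  have hla : l ^ (2 * ρ) = energy K ρ p := by
    rw [hl, ← Real.rpow_mul hE.le, one_div_mul_cancel (by positivity), Real.rpow_one]
  have hld : l ^ d = energy K ρ p ^ (d / (2 * ρ)) := by
    rw [hl, ← Real.rpow_mul hE.le]; congr 1; ring
  set y : ℝ × ℝ := (p.1 / l, p.2 / l ^ ρ) with hy
  have hpy : (l * y.1, l ^ ρ * y.2) = p := by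
    have : l ^ ρ ≠ 0 := by positivity
    ext <;> simp only [hy] <;> field_simp
  have hEy : energy K ρ y = 1 := by
    have h := energy_dilation (K := K) (ρ := ρ) hl0 y
    rw [hpy, hla] at h
    exact mul_left_cancel₀ hE.ne' (by rw [← h, mul_one])
  have h := hf l hl0 y
  rw [hpy, hld] at h
  rw [h, mul_comm]
  exact mul_le_mul_of_nonneg_right (hM y hEy) (by positivity)

theorem exists_pos_forall_neg_add_mul_le {X : Type*} [TopologicalSpace X] {S : Set X}
    (hS : IsCompact S) {A B : X → ℝ} (hA : Continuous A) (hB : Continuous B)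
    (hA0 : ∀ x ∈ S, 0 ≤ A x) (hAB : ∀ x ∈ S, 0 ≤ B x → 0 < A x) {δ : ℝ} (hδ : 0 < δ) :
    ∃ e, 0 < e ∧ e ≤ δ ∧ ∃ c, 0 < c ∧ ∀ x ∈ S, -A x + e * B x ≤ -c := by
  obtain ⟨e, he, heδ, hneg⟩ : ∃ e, 0 < e ∧ e ≤ δ ∧ ∀ x ∈ S, -A x + e * B x < 0 := by
    have hS' : IsCompact (S ∩ {x | 0 ≤ B x}) := hS.inter_right (isClosed_le continuous_const hB)
    obtain ⟨a, ha, haS⟩ := hS'.exists_forall_le' hA.continuousOn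
      (a := 0) fun x hx => hAB x hx.1 hx.2
    obtain ⟨b, hb⟩ := hS.bddAbove_image hB.continuousOn
    have hb' : ∀ x ∈ S, B x ≤ |b| := fun x hx => (hb (mem_image_of_mem B hx)).trans (le_abs_self b)
    refine ⟨min δ (a / (2 * (|b| + 1))), by positivity, min_le_left _ _, fun x hx => ?_⟩
    set e := min δ (a / (2 * (|b| + 1)))
    have he : 0 < e := by positivity
    rcases lt_or_ge (B x) 0 with h | h
    · have := mul_neg_of_pos_of_neg he h
      have := hA0 x hx
      linarith
    · have h1 := haS x ⟨hx, h⟩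
      have h2 : e * B x ≤ e * |b| := mul_le_mul_of_nonneg_left (hb' x hx) he.le
      have h3 : e * (2 * (|b| + 1)) ≤ a := by
        rw [← le_div_iff₀ (by positivity)]; exact min_le_right _ _
      have h4 : 0 ≤ e * |b| := by positivity
      nlinarith
  refine ⟨e, he, heδ, ?_⟩
  obtain ⟨c, hc, hcS⟩ := hS.exists_forall_le' (f := fun x => A x - e * B x)
    (hA.sub (hB.const_mul e)).continuousOn (a := 0) fun x hx => by linarith [hneg x hx]
  exact ⟨c, hc, fun x hx => by linarith [hcS x hx]⟩

/-- Small-time stability of a double integrator with a weighted-homogeneous feedback `-G` of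
negative degree that is strictly monotone in the velocity and restoring at rest. -/
theorem smallTimeStable_of_homogeneous_feedback {K ρ : ℝ} {G : ℝ × ℝ → ℝ} (hK : 0 < K)
    (hρ : 1 / 2 < ρ) (hρ1 : ρ < 1) (hG : Continuous G)
    (hdil : ∀ l > 0, ∀ y : ℝ × ℝ, G (l * y.1, l ^ ρ * y.2) = l ^ (2 * ρ - 1) * G y)
    (hmono : ∀ s, StrictMono fun v => G (s, v))
    (hrest : ∀ s, G (s, 0) = K * spow s (2 * ρ - 1)) :
    SmallTimeStable fun p : ℝ × ℝ => (p.2, -G p) := by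
  have hρ0 : 0 < ρ := by linarith
  set m : ℝ := (1 + ρ) / (2 * ρ) with hm
  have hm1 : 1 < m := by rw [hm, one_lt_div (by positivity)]; linarith
  have hm0 : 0 < m := by linarith
  have hEc : Continuous (energy K ρ) := continuous_energy hρ0
  have hE0 : ∀ p, 0 ≤ energy K ρ p := energy_nonneg hK hρ0
  have hEz : energy K ρ 0 = 0 := by
    simp [energy, Real.zero_rpow (show 2 * ρ ≠ 0 by positivity)]
  have hS := isCompact_energy_eq_one hK hρ0
  have hl2 : ∀ l : ℝ, 0 < l → l * l ^ (2 * ρ - 1) = l ^ (2 * ρ) := fun l hl => by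
    rw [Real.rpow_sub_one hl.ne']; field_simp
  -- dissipation rate of the energy
  set A : ℝ × ℝ → ℝ := fun p => p.2 * (G p - K * spow p.1 (2 * ρ - 1)) with hA
  -- derivative of `x₁ x₂`
  set B : ℝ × ℝ → ℝ := fun p => p.2 ^ 2 - p.1 * G p with hB
  have hAc : Continuous A := by
    have := (continuous_spow (show 0 < 2 * ρ - 1 by linarith)).comp
      (continuous_fst (X := ℝ) (Y := ℝ))
    exact continuous_snd.mul (hG.sub (continuous_const.mul this))
  have hBc : Continuous B := by fun_prop
  have hA0 : ∀ p, p.2 ≠ 0 → 0 < A p := by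
    rintro ⟨s, v⟩ hv
    simp only [hA]
    rw [← hrest]
    rcases lt_or_gt_of_ne hv with h | h
    · have : G (s, v) < G (s, 0) := hmono s h
      exact mul_pos_of_neg_of_neg h (by linarith)
    · have : G (s, 0) < G (s, v) := hmono s h
      exact mul_pos h (by linarith)
  have hA0' : ∀ p, 0 ≤ A p := fun p => by
    by_cases h : p.2 = 0
    · simp [hA, h]
    · exact (hA0 p h).le
  have hAB : ∀ p, energy K ρ p = 1 → 0 ≤ B p → 0 < m * A p := by
    rintro ⟨s, v⟩ hp hBp
    refine mul_pos hm0 (hA0 _ fun hv => ?_)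
    obtain rfl : v = 0 := hv
    have hs : s ≠ 0 := by
      rintro rfl
      have : energy K ρ (0, 0) = 0 := hEz
      linarith
    have h1 : B (s, 0) = -(K * |s| ^ (2 * ρ)) := by
      have := mul_spow_self (a := 2 * ρ - 1) (by linarith) s
      rw [sub_add_cancel] at this
      simp only [hB, hrest]
      rw [← this]; ring
    have : 0 < K * |s| ^ (2 * ρ) := by positivity
    linarith
  obtain ⟨b, hb⟩ := hS.bddAbove_image (f := fun p : ℝ × ℝ => |p.1 * p.2|) (by fun_prop)
  have hb' : ∀ p, energy K ρ p = 1 → |p.1 * p.2| ≤ |b| := fun p hp =>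
    (hb (mem_image_of_mem _ hp)).trans (le_abs_self b)
  obtain ⟨e, he, heb, c, hc, hcS⟩ := exists_pos_forall_neg_add_mul_le hS
    (hAc.const_mul m) hBc (fun p _ => mul_nonneg hm0.le (hA0' p)) hAB
    (δ := 1 / (2 * (|b| + 1))) (by positivity)
  have hcross : ∀ p, e * |p.1 * p.2| ≤ 1 / 2 * energy K ρ p ^ m := by
    intro p
    by_cases hp : p = 0
    · subst hp
      simp [hEz, Real.zero_rpow hm0.ne']
    · refine le_mul_energy_rpow_of_homogeneous (f := fun p => e * |p.1 * p.2|) hK hρ0 ?_ ?_ hp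
      · intro l hl y
        have h1 : l * y.1 * (l ^ ρ * y.2) = l ^ (1 + ρ) * (y.1 * y.2) := by
          rw [Real.rpow_add hl, Real.rpow_one]; ring
        have h2 : 0 < l ^ (1 + ρ) := by positivity
        simp only [h1]
        rw [abs_mul, abs_of_pos h2]; ring
      · intro y hy
        calc e * |y.1 * y.2| ≤ 1 / (2 * (|b| + 1)) * |b| :=
              mul_le_mul heb (hb' y hy) (abs_nonneg _) (by positivity)
          _ ≤ 1 / 2 := by
            rw [one_div_mul_eq_div, div_le_iff₀ (by positivity)]
            linarith
  -- the strict Lyapunov function and its derivative along the flow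
  set W : ℝ × ℝ → ℝ := fun p => energy K ρ p ^ m + e * (p.1 * p.2) with hW
  set D : ℝ × ℝ → ℝ := fun p => -(m * A p) * energy K ρ p ^ (m - 1) + e * B p with hD
  have hWlow : ∀ p, 1 / 2 * energy K ρ p ^ m ≤ W p := fun p => by
    have h1 := hcross p
    have h2 := mul_le_mul_of_nonneg_left (neg_abs_le (p.1 * p.2)) he.le
    simp only [hW]; linarith
  have hWup : ∀ p, W p ≤ 2 * energy K ρ p ^ m := fun p => by
    have h1 := hcross p
    have h2 := mul_le_mul_of_nonneg_left (le_abs_self (p.1 * p.2)) he.le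
    have h3 := Real.rpow_nonneg (hE0 p) m
    simp only [hW]; linarith
  have hW0 : ∀ p, 0 ≤ W p := fun p => by
    have := Real.rpow_nonneg (hE0 p) m
    linarith [hWlow p]
  have hDle : ∀ p, D p ≤ -c * energy K ρ p := by
    intro p
    by_cases hp : p = 0
    · subst hp
      simp [hD, hA, hB, hEz]
    · have h := le_mul_energy_rpow_of_homogeneous (f := D) (d := 2 * ρ) (M := -c) hK hρ0 ?_ ?_ hp
      · rwa [div_self (by positivity), Real.rpow_one] at h
      · intro l hl y
        have h1 : (l ^ ρ) ^ 2 = l ^ (2 * ρ) := by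
          rw [← Real.rpow_natCast, ← Real.rpow_mul hl.le]; congr 1; push_cast; ring
        have h2 : A (l * y.1, l ^ ρ * y.2) = l ^ (3 * ρ - 1) * A y := by
          have h3 : l ^ (3 * ρ - 1) = l ^ ρ * l ^ (2 * ρ - 1) := by
            rw [← Real.rpow_add hl]; congr 1; ring
          simp only [hA, hdil l hl, spow_mul_of_pos hl, h3]
          ring
        have h3 : B (l * y.1, l ^ ρ * y.2) = l ^ (2 * ρ) * B y := by
          simp only [hB, hdil l hl, mul_pow, h1, ← hl2 l hl]
          ring
        have h4 : energy K ρ (l * y.1, l ^ ρ * y.2) ^ (m - 1)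
            = l ^ (1 - ρ) * energy K ρ y ^ (m - 1) := by
          rw [energy_dilation hl, Real.mul_rpow (by positivity) (hE0 y), ← Real.rpow_mul hl.le]
          congr 2
          rw [hm]; field_simp; ring
        have h5 : l ^ (2 * ρ) = l ^ (3 * ρ - 1) * l ^ (1 - ρ) := by
          rw [← Real.rpow_add hl]; congr 1; ring
        simp only [hD, h2, h3, h4]
        rw [h5]; ring
      · intro y hy
        have := hcS y hy
        simp only [hD, hy, Real.one_rpow, mul_one]
        exact this
  have hDW : ∀ p, D p ≤ -(c / 2 ^ (1 / m)) * W p ^ (1 / m) := by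
    intro p
    refine (hDle p).trans ?_
    have h1 : W p ^ (1 / m) ≤ 2 ^ (1 / m) * energy K ρ p := by
      have h := Real.rpow_le_rpow (hW0 p) (hWup p) (show 0 ≤ 1 / m by positivity)
      rwa [Real.mul_rpow zero_le_two (Real.rpow_nonneg (hE0 p) m), ← Real.rpow_mul (hE0 p),
        mul_one_div_cancel hm0.ne', Real.rpow_one] at h
    have h2 : c / 2 ^ (1 / m) * W p ^ (1 / m) ≤ c / 2 ^ (1 / m) * (2 ^ (1 / m) * energy K ρ p) :=
      mul_le_mul_of_nonneg_left h1 (by positivity)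
    have h3 : c / 2 ^ (1 / m) * (2 ^ (1 / m) * energy K ρ p) = c * energy K ρ p := by
      field_simp
    linarith
  have hθ : 1 / m < 1 := by rw [div_lt_one hm0]; exact hm1
  set θ := 1 / m
  set c' := c / 2 ^ θ
  have hc' : 0 < c' := by positivity
  have hWc : Continuous W := by
    have := hEc.rpow_const (p := m) fun _ => Or.inr hm0.le
    fun_prop
  have hWz : W 0 = 0 := by simp [hW, hEz, Real.zero_rpow hm0.ne']
  have hder : ∀ x : ℝ → ℝ × ℝ, IsSolOn (fun p : ℝ × ℝ => (p.2, -G p)) x 0 → ∀ t, 0 ≤ t →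
      HasDerivWithinAt (fun t => W (x t)) (D (x t)) (Ici 0) t := by
    intro x hx t ht
    have h := hx t ht
    have h1 : HasDerivWithinAt (fun t => (x t).1) (x t).2 (Ici 0) t := h.fst
    have h2 : HasDerivWithinAt (fun t => (x t).2) (-G (x t)) (Ici 0) t := h.snd
    have h3 : HasDerivWithinAt (fun t => energy K ρ (x t)) (-A (x t)) (Ici 0) t := by
      have h4 := (hasDerivAt_abs_rpow (x t).1 (show 1 < 2 * ρ by linarith)).comp_hasDerivWithinAt
        t h1
      have h5 := ((h2.pow 2).div_const 2).add (h4.const_mul (K / (2 * ρ)))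
      refine h5.congr_deriv ?_
      have h6 := abs_rpow_sub_one_mul_self (x t).1 (2 * ρ - 1)
      rw [show 2 * ρ - 1 - 1 = 2 * ρ - 2 by ring] at h6
      simp only [hA]
      rw [← h6]
      field_simp
      push_cast
      ring
    have h7 := (h3.rpow_const (p := m) (Or.inr hm1.le)).add ((h1.mul h2).const_mul e)
    refine h7.congr_deriv ?_
    simp only [hD, hB]
    ring
  intro ε hε
  set e₀ := min (ε ^ 2 / 2) (K / (2 * ρ) * ε ^ (2 * ρ)) with he₀
  have he₀pos : 0 < e₀ := by positivity
  have hcont : Tendsto (fun p => W p ^ (1 - θ)) (nhds 0) (nhds 0) := by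
    have h := (hWc.rpow_const (p := 1 - θ) fun _ => Or.inr (by linarith)).tendsto 0
    rwa [hWz, Real.zero_rpow (by linarith)] at h
  have hev : ∀ᶠ p in nhds (0 : ℝ × ℝ), W p < 1 / 2 * e₀ ^ m ∧ W p ^ (1 - θ) < c' * (1 - θ) * ε := by
    refine ((hWc.tendsto 0).eventually_lt_const ?_).and (hcont.eventually_lt_const ?_)
    · rw [hWz]; positivity
    · exact mul_pos (mul_pos hc' (by linarith)) hε
  obtain ⟨η, hη, hball⟩ := Metric.eventually_nhds_iff.1 hev
  refine ⟨η, hη, fun x hx hx0 => ?_⟩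
  obtain ⟨hs1, hs2⟩ := hball (y := x 0) (by simpa using hx0)
  obtain ⟨hanti, hext⟩ := finite_time_extinction hc' hθ (hder x hx) (fun t _ => hW0 (x t))
    fun t _ => hDW (x t)
  constructor
  · by_contra hne
    have h1 := hext ε hε.le hs2
    have h2 := hWlow (x ε)
    have h3 : 0 < energy K ρ (x ε) ^ m := Real.rpow_pos_of_pos (energy_pos hK hρ0 hne) m
    linarith
  · intro t ht
    refine norm_lt_of_energy_lt hK hρ0 hε ?_
    have h1 : W (x t) ≤ W (x 0) := hanti self_mem_Ici ht ht
    have h2 := hWlow (x t)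
    exact (Real.rpow_lt_rpow_iff (hE0 _) he₀pos.le hm0).1 (by linarith)

/-- Small-time stabilization of the double integrator by
`u = -k₂⌊⌊x₂⌉^{(1-κ)/(1+κ)} + k₁^{(1-κ)/(1+κ)}⌊x₁⌉^{1-κ}⌉^{(1+2κ)/(1-κ)}`. -/
theorem stmt7 (κ k₁ k₂ : ℝ) (hκ₁ : -(1/2) < κ) (hκ₂ : κ < 0) (hk₁ : 0 < k₁)
    (hk₂ : (1 - κ^2) / (2 + κ) * 2 ^ ((1 - 4*κ - 3*κ^2) / (1 - κ^2)) * k₁ ^ (1/(1+κ)) < k₂) :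
    SmallTimeStable (fun p : ℝ × ℝ =>
      (p.2, -k₂ * spow (spow p.2 ((1-κ)/(1+κ)) + k₁ ^ ((1-κ)/(1+κ)) * spow p.1 (1-κ))
        ((1 + 2*κ) / (1 - κ)))) := by
  have hk₂0 : 0 < k₂ := by
    have h1 : 0 < 1 - κ ^ 2 := by nlinarith
    have h2 : 0 < 2 + κ := by linarith
    exact lt_trans (by positivity) hk₂
  have ha : 0 < 1 + κ := by linarith
  have hr : 0 < 1 - κ := by linarith
  have hP : 0 < (1 - κ) / (1 + κ) := by positivity
  have hq : 0 < (1 + 2 * κ) / (1 - κ) := div_pos (by linarith) hr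
  have hC : 0 < k₁ ^ ((1 - κ) / (1 + κ)) := by positivity
  have hrq : (1 - κ) * ((1 + 2 * κ) / (1 - κ)) = 2 * (1 + κ) - 1 := by field_simp; ring
  have haP : (1 + κ) * ((1 - κ) / (1 + κ)) = 1 - κ := by field_simp
  generalize (1 - κ) / (1 + κ) = P at *
  generalize (1 + 2 * κ) / (1 - κ) = q at *
  generalize k₁ ^ P = C at *
  simp only [neg_mul]
  refine smallTimeStable_of_homogeneous_feedback (K := k₂ * C ^ q) (ρ := 1 + κ)
    (G := fun p => k₂ * spow (spow p.2 P + C * spow p.1 (1 - κ)) q)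
    (by positivity) (by linarith) (by linarith) ?_ ?_ ?_ ?_
  · have h1 := (continuous_spow hP).comp (continuous_snd (X := ℝ) (Y := ℝ))
    have h2 := (continuous_spow hr).comp (continuous_fst (X := ℝ) (Y := ℝ))
    exact continuous_const.mul ((continuous_spow hq).comp (h1.add (continuous_const.mul h2)))
  · intro l hl y
    simp only
    rw [spow_mul_of_pos hl, spow_mul_of_pos (Real.rpow_pos_of_pos hl _), ← Real.rpow_mul hl.le,
      haP, ← hrq, Real.rpow_mul hl.le (1 - κ) q, mul_left_comm C,
      ← mul_add, spow_mul_of_pos (Real.rpow_pos_of_pos hl _), mul_left_comm k₂]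
  · intro s v w hvw
    exact mul_lt_mul_of_pos_left
      (strictMono_spow hq (add_lt_add_left (strictMono_spow hP hvw) _)) hk₂0
  · intro s
    simp only
    rw [spow_zero_left, zero_add, spow_mul_of_pos hC, spow_spow, hrq, mul_assoc]
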